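/- Let A be an algebra with Day operations m₀,…,m_n, let k ≥ 2, T = (θ₀,…,θ_{k-1}) ∈ Con(A)^k, and δ ∈ Con(A). Then C(T; j; δ) holds for every j < k if and only if the two term condition C_tt(T; δ) holds. -/

import Mathlib

namespace UACommutator

/-- A signature: a type of operation symbols with arities. -/
structure Signature where
  ops : Type
  arity : ops → ℕ

/-- An algebra for a signature: a nonempty carrier with interpretations of the operations. -/
structure Alg (σ : Signature) where
  carrier : Type
  nonempty : Nonempty carrier
  interp : (o : σ.ops) → (Fin (σ.arity o) → carrier) → carrier

/-- A congruence of an algebra: an equivalence relation compatible with all basic operations. -/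
structure Congruence {σ : Signature} (A : Alg σ) where
  rel : A.carrier → A.carrier → Prop
  iseqv : Equivalence rel
  compat : ∀ (o : σ.ops) (x y : Fin (σ.arity o) → A.carrier),
    (∀ i, rel (x i) (y i)) → rel (A.interp o x) (A.interp o y)

instance {σ : Signature} {A : Alg σ} : LE (Congruence A) :=
  ⟨fun a b => ∀ x y, a.rel x y → b.rel x y⟩

/-- Terms of the signature with variables in `V`. -/
inductive Term (σ : Signature) (V : Type) : Type
  | var : V → Term σ V
  | app : (o : σ.ops) → (Fin (σ.arity o) → Term σ V) → Term σ V

def Term.evalA {σ : Signature} (A : Alg σ) {V : Type} :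
    Term σ V → (V → A.carrier) → A.carrier
  | .var v, env => env v
  | .app o args, env => A.interp o (fun i => (args i).evalA A env)

/-- Polynomial operations of an algebra `A` with variables in `V`:
built from variables, constants of `A`, and the basic operations. -/
inductive Poly {σ : Signature} (A : Alg σ) (V : Type) : Type
  | var : V → Poly A V
  | const : A.carrier → Poly A V
  | app : (o : σ.ops) → (Fin (σ.arity o) → Poly A V) → Poly A V

def Poly.eval {σ : Signature} {A : Alg σ} {V : Type} :
    Poly A V → (V → A.carrier) → A.carrier
  | .var v, env => env v
  | .const c, _ => c
  | .app o args, env => A.interp o (fun i => (args i).eval env)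

/-- Evaluate a polynomial whose variables are grouped into `k` tuples (tuple `i` of
length `ν i`) at the tuples `a i` (where `g i = false`) or `b i` (where `g i = true`). -/
def evalTup {σ : Signature} {A : Alg σ} {k : ℕ} {ν : Fin k → ℕ}
    (p : Poly A (Σ i, Fin (ν i))) (a b : ∀ i, Fin (ν i) → A.carrier)
    (g : Fin k → Bool) : A.carrier :=
  p.eval (fun x => if g x.1 then b x.1 x.2 else a x.1 x.2)

/-- The term condition `C(α₀,…,α_{k-1}; δ)`, centralizing at coordinate `j`. -/
def TC {σ : Signature} {A : Alg σ} {k : ℕ} (α : Fin k → Congruence A) (j : Fin k)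
    (δ : Congruence A) : Prop :=
  ∀ (ν : Fin k → ℕ) (p : Poly A (Σ i, Fin (ν i)))
    (a b : ∀ i, Fin (ν i) → A.carrier),
    (∀ i mm, (α i).rel (a i mm) (b i mm)) →
    (∀ g : Fin k → Bool, g j = false → (∃ i, i ≠ j ∧ g i = false) →
      δ.rel (evalTup p a b g) (evalTup p a b (Function.update g j true))) →
    δ.rel (evalTup p a b (Function.update (fun _ => true) j false))
          (evalTup p a b (fun _ => true))

/-- The meet (intersection) of a family of congruences. -/
def infCong {σ : Signature} {A : Alg σ} {ι : Sort*} (ds : ι → Congruence A) :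
    Congruence A where
  rel x y := ∀ i, (ds i).rel x y
  iseqv := ⟨fun x i => (ds i).iseqv.refl x,
            fun h i => (ds i).iseqv.symm (h i),
            fun h h' i => (ds i).iseqv.trans (h i) (h' i)⟩
  compat o x y h := fun i => (ds i).compat o x y (fun mm => h mm i)

/-- The higher commutator `[α₀,…,α_{k-1}]` (term-condition version), as the meet of
all congruences `δ` such that `C(α₀,…,α_{k-1}; δ)` holds, centralizing at `j`. -/
def commTC {σ : Signature} {A : Alg σ} {k : ℕ} (α : Fin k → Congruence A) (j : Fin k) :
    Congruence A :=
  infCong (fun d : {δ : Congruence A // TC α j δ} => d.val)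

/-- The congruence generated by a binary relation `X`. -/
def Cg {σ : Signature} {A : Alg σ} (X : A.carrier → A.carrier → Prop) : Congruence A :=
  infCong (fun d : {δ : Congruence A // ∀ x y, X x y → δ.rel x y} => d.val)

theorem Cg_base {σ : Signature} {A : Alg σ} (X : A.carrier → A.carrier → Prop)
    {x y : A.carrier} (h : X x y) : (Cg X).rel x y :=
  fun i => i.2 x y h

/-- The join of a family of congruences: the least congruence containing every member. -/
def supCong {σ : Signature} {A : Alg σ} {ι : Sort*} (γ : ι → Congruence A) :
    Congruence A :=
  Cg (fun x y => ∃ i, (γ i).rel x y)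

/-- The join of two congruences. -/
def joinCong {σ : Signature} {A : Alg σ} (a b : Congruence A) : Congruence A :=
  Cg (fun x y => a.rel x y ∨ b.rel x y)

/-- `m` is a `T`-matrix for `T = (θ₀,…,θ_{k-1})`. -/
def IsMatrix {σ : Signature} {A : Alg σ} {k : ℕ} (θ : Fin k → Congruence A)
    (m : (Fin k → Bool) → A.carrier) : Prop :=
  ∃ (ν : Fin k → ℕ) (p : Poly A (Σ i, Fin (ν i))) (a b : ∀ i, Fin (ν i) → A.carrier),
    (∀ i jj, (θ i).rel (a i jj) (b i jj)) ∧
    ∀ f : Fin k → Bool, m f = evalTup p a b f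

/-- The matrix centralization condition `C(T; j; δ)`: for every `T`-matrix, if every
`(j)`-supporting line is a `δ`-pair then the `(j)`-pivot line is a `δ`-pair. -/
def CMat {σ : Signature} {A : Alg σ} {k : ℕ} (θ : Fin k → Congruence A) (j : Fin k)
    (δ : Congruence A) : Prop :=
  ∀ m : (Fin k → Bool) → A.carrier, IsMatrix θ m →
    (∀ g : Fin k → Bool, (∃ i, i ≠ j ∧ g i = false) →
      δ.rel (m (Function.update g j false)) (m (Function.update g j true))) →
    δ.rel (m (Function.update (fun _ => true) j false)) (m (fun _ => true))

/-- `[T]_j`: the meet of all congruences `δ` with `C(T; j; δ)`. -/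
def commMat {σ : Signature} {A : Alg σ} {k : ℕ} (θ : Fin k → Congruence A) (j : Fin k) :
    Congruence A :=
  infCong (fun d : {δ : Congruence A // CMat θ j δ} => d.val)

/-- Day operations `m₀, …, m_n` for an algebra, each induced by a term of the signature. -/
structure DayOps {σ : Signature} (A : Alg σ) (n : ℕ) where
  m : Fin (n+1) → A.carrier → A.carrier → A.carrier → A.carrier → A.carrier
  isTerm : ∀ e, ∃ t : Term σ (Fin 4), ∀ x y z u, m e x y z u = t.evalA A ![x, y, z, u]
  idem : ∀ e x y, m e x y y x = x
  first : ∀ x y z u, m 0 x y z u = x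
  last : ∀ x y z u, m (Fin.last n) x y z u = u
  even : ∀ (e : ℕ) (he : e < n), Even e → ∀ x u,
    m ⟨e, by omega⟩ x x u u = m ⟨e+1, by omega⟩ x x u u
  odd : ∀ (e : ℕ) (he : e < n), Odd e → ∀ x y u,
    m ⟨e, by omega⟩ x y y u = m ⟨e+1, by omega⟩ x y y u

/-- The `e`-th shift rotation at `(j, l)` of a cube `h`. -/
def shiftRot {σ : Signature} {A : Alg σ} {n k : ℕ} (D : DayOps A n) (e : Fin (n+1))
    (j l : Fin k) (h : (Fin k → Bool) → A.carrier) :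
    (Fin k → Bool) → A.carrier := fun f =>
  let r := h (Function.update (Function.update f j false) l false)
  let s := h (Function.update (Function.update f j false) l true)
  let u := h (Function.update (Function.update f j true) l false)
  let v := h (Function.update (Function.update f j true) l true)
  if f j then (if f l then D.m e s s v v else D.m e s r u v) else s

/-- `hIter D m hm d h` is `h^{(d₀,…,d_{m-1})}`: the result of applying the shift
rotations `R^{d₀}_{0,1}, …, R^{d_{m-1}}_{m-1,m}` successively to `h`. -/
def hIter {σ : Signature} {A : Alg σ} {n k : ℕ} (D : DayOps A n) :
    (m : ℕ) → m < k → (Fin m → Fin (n+1)) → ((Fin k → Bool) → A.carrier) →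
    ((Fin k → Bool) → A.carrier)
  | 0, _, _, h => h
  | (m+1), hm, d, h =>
      shiftRot D (d (Fin.last m)) ⟨m, by omega⟩ ⟨m+1, hm⟩
        (hIter D m (by omega) (fun i => d i.castSucc) h)

/-- `X(T)`: the set of `(k-1)`-pivot lines of the matrices `h^d`, over all `T`-matrices
`h` and all `d ∈ {0,…,n}^{k-1}`. -/
def XSet {σ : Signature} {A : Alg σ} {n k : ℕ} (hk : 0 < k) (D : DayOps A n)
    (θ : Fin k → Congruence A) : A.carrier → A.carrier → Prop :=
  fun x y => ∃ h : (Fin k → Bool) → A.carrier, IsMatrix θ h ∧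
    ∃ d : Fin (k-1) → Fin (n+1),
      x = hIter D (k-1) (by omega) d h
            (Function.update (fun _ => true) (⟨k-1, by omega⟩ : Fin k) false) ∧
      y = hIter D (k-1) (by omega) d h (fun _ => true)

/-- Product algebra `A^I` with pointwise operations. -/
def prodAlg {σ : Signature} (A : Alg σ) (I : Type) : Alg σ where
  carrier := I → A.carrier
  nonempty := ⟨fun _ => Classical.choice A.nonempty⟩
  interp o x := fun i => A.interp o (fun mm => x mm i)

/-- Membership in the subalgebra of `B` generated by a set `S`. -/
inductive Gen {σ : Signature} (B : Alg σ) (S : Set B.carrier) : B.carrier → Prop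
  | base : ∀ x ∈ S, Gen B S x
  | app : ∀ (o : σ.ops) (x : Fin (σ.arity o) → B.carrier),
      (∀ i, Gen B S (x i)) → Gen B S (B.interp o x)

/-- `f : A → B` is a homomorphism. -/
def IsHom {σ : Signature} (A B : Alg σ) (f : A.carrier → B.carrier) : Prop :=
  ∀ (o : σ.ops) (x : Fin (σ.arity o) → A.carrier),
    f (A.interp o x) = B.interp o (fun i => f (x i))

/-- The kernel congruence of a homomorphism. -/
def kerCong {σ : Signature} {A B : Alg σ} (f : A.carrier → B.carrier)
    (hf : IsHom A B f) : Congruence A where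
  rel x y := f x = f y
  iseqv := ⟨fun _ => rfl, Eq.symm, Eq.trans⟩
  compat o x y h := by
    show f (A.interp o x) = f (A.interp o y)
    rw [hf o x, hf o y]
    congr 1
    funext i
    exact h i

/-- The image `f(γ)` of a congruence `γ ≥ ker f` under a surjective homomorphism `f`. -/
def mapCong {σ : Signature} {A B : Alg σ} (f : A.carrier → B.carrier)
    (hf : IsHom A B f) (hs : Function.Surjective f) (γ : Congruence A)
    (hγ : ∀ x y, f x = f y → γ.rel x y) : Congruence B where
  rel u v := ∃ x y, γ.rel x y ∧ f x = u ∧ f y = v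
  iseqv := by
    refine ⟨?_, ?_, ?_⟩
    · intro u
      obtain ⟨x, hx⟩ := hs u
      exact ⟨x, x, γ.iseqv.refl x, hx, hx⟩
    · rintro u v ⟨x, y, hxy, hx, hy⟩
      exact ⟨y, x, γ.iseqv.symm hxy, hy, hx⟩
    · rintro u v w ⟨x, y, hxy, hx, hy⟩ ⟨y', z, hyz, hy', hz⟩
      exact ⟨x, z, γ.iseqv.trans hxy (γ.iseqv.trans (hγ y y' (hy.trans hy'.symm)) hyz),
        hx, hz⟩
  compat o u v h := by
    choose x y hxy hx hy using h
    refine ⟨A.interp o x, A.interp o y, γ.compat o x y hxy, ?_, ?_⟩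
    · rw [hf o x]
      congr 1
      funext i
      exact hx i
    · rw [hf o y]
      congr 1
      funext i
      exact hy i

/-- The preimage `f⁻¹(β)` of a congruence of `B` under a homomorphism `f`. -/
def comapCong {σ : Signature} {A B : Alg σ} (f : A.carrier → B.carrier)
    (hf : IsHom A B f) (β : Congruence B) : Congruence A where
  rel x y := β.rel (f x) (f y)
  iseqv := ⟨fun _ => β.iseqv.refl _, β.iseqv.symm, β.iseqv.trans⟩
  compat o x y h := by
    show β.rel (f (A.interp o x)) (f (A.interp o y))
    rw [hf o x, hf o y]
    exact β.compat o _ _ h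

/-- The higher two term condition `C_tt(T; δ)`. -/
def CttMat {σ : Signature} {A : Alg σ} {k : ℕ} (θ : Fin k → Congruence A)
    (δ : Congruence A) : Prop :=
  ∀ h g : (Fin k → Bool) → A.carrier, IsMatrix θ h → IsMatrix θ g →
    (∀ f : Fin k → Bool, f ≠ (fun _ => true) → δ.rel (h f) (g f)) →
    ∀ f : Fin k → Bool, δ.rel (h f) (g f)

/-- Rename the variables of a polynomial. -/
def Poly.rename {σ : Signature} {A : Alg σ} {V W : Type} (φ : V → W) : Poly A V → Poly A W
  | .var v => .var (φ v)
  | .const c => .const c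
  | .app o args => .app o (fun i => (args i).rename φ)

theorem Poly.eval_rename {σ : Signature} {A : Alg σ} {V W : Type} (φ : V → W)
    (p : Poly A V) (env : W → A.carrier) :
    (p.rename φ).eval env = p.eval (env ∘ φ) := by
  induction p with
  | var v => rfl
  | const c => rfl
  | app o args ih => exact congrArg (A.interp o) (funext ih)

/-- Substitute polynomials for the variables of a term. -/
def Term.substPoly {σ : Signature} {A : Alg σ} {V W : Type} (q : V → Poly A W) :
    Term σ V → Poly A W
  | .var v => q v
  | .app o args => .app o (fun i => (args i).substPoly q)

theorem Term.eval_substPoly {σ : Signature} {A : Alg σ} {V W : Type} (q : V → Poly A W)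
    (t : Term σ V) (env : W → A.carrier) :
    (t.substPoly q).eval env = t.evalA A (fun v => (q v).eval env) := by
  induction t with
  | var v => rfl
  | app o args ih => exact congrArg (A.interp o) (funext ih)

theorem Term.evalA_rel {σ : Signature} {A : Alg σ} {V : Type} (δ : Congruence A)
    (t : Term σ V) {x y : V → A.carrier} (h : ∀ v, δ.rel (x v) (y v)) :
    δ.rel (t.evalA A x) (t.evalA A y) := by
  induction t with
  | var v => exact h v
  | app o args ih => exact δ.compat o _ _ ih

/-- The `T`-matrices are closed under term operations applied entrywise. -/
theorem IsMatrix.term {σ : Signature} {A : Alg σ} {k N : ℕ} {θ : Fin k → Congruence A}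
    (t : Term σ (Fin N)) {M : Fin N → (Fin k → Bool) → A.carrier}
    (hM : ∀ s, IsMatrix θ (M s)) :
    IsMatrix θ (fun f => t.evalA A (fun s => M s f)) := by
  choose ν p a b hab hm using hM
  let φ (s : Fin N) (x : Σ i, Fin (ν s i)) : Σ i, Fin (∑ s, ν s i) :=
    ⟨x.1, finSigmaFinEquiv ⟨s, x.2⟩⟩
  refine ⟨fun i => ∑ s, ν s i, t.substPoly (fun s => (p s).rename (φ s)),
    fun i x => a (finSigmaFinEquiv.symm x).1 i (finSigmaFinEquiv.symm x).2,
    fun i x => b (finSigmaFinEquiv.symm x).1 i (finSigmaFinEquiv.symm x).2,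
    fun i x => hab _ i _, fun f => ?_⟩
  rw [evalTup, Term.eval_substPoly]
  refine congrArg (t.evalA A) (funext fun s => ?_)
  rw [hm, Poly.eval_rename, evalTup]
  congr 1
  funext x
  simp only [φ, Function.comp_apply]
  rw [Equiv.symm_apply_apply]

/-- Freezing one coordinate of a `T`-matrix gives a `T`-matrix. -/
theorem IsMatrix.update {σ : Signature} {A : Alg σ} {k : ℕ} {θ : Fin k → Congruence A}
    {m : (Fin k → Bool) → A.carrier} (hm : IsMatrix θ m) (j : Fin k) (c : Bool) :
    IsMatrix θ (fun f => m (Function.update f j c)) := by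
  obtain ⟨ν, p, a, b, hab, hm⟩ := hm
  refine ⟨ν, p, fun i x => if i = j then (if c then b i x else a i x) else a i x,
    fun i x => if i = j then (if c then b i x else a i x) else b i x, fun i x => ?_,
    fun f => ?_⟩
  · by_cases h : i = j
    · simpa only [h, if_true] using (θ j).iseqv.refl _
    · simpa only [h, if_false] using hab i x
  · refine (hm _).trans ?_
    rw [evalTup, evalTup]
    congr 1
    funext x
    by_cases h : x.1 = j
    · simp [h]
    · simp [h]

theorem DayOps.rel {σ : Signature} {A : Alg σ} {n : ℕ} (D : DayOps A n) (δ : Congruence A)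
    (e : Fin (n + 1)) {x y z u x' y' z' u' : A.carrier} (hx : δ.rel x x') (hy : δ.rel y y')
    (hz : δ.rel z z') (hu : δ.rel u u') : δ.rel (D.m e x y z u) (D.m e x' y' z' u') := by
  obtain ⟨t, ht⟩ := D.isTerm e
  rw [ht, ht]
  refine t.evalA_rel δ fun v => ?_
  fin_cases v <;> assumption

theorem IsMatrix.day {σ : Signature} {A : Alg σ} {n k : ℕ} {θ : Fin k → Congruence A}
    (D : DayOps A n) (e : Fin (n + 1)) {x y z u : (Fin k → Bool) → A.carrier}
    (hx : IsMatrix θ x) (hy : IsMatrix θ y) (hz : IsMatrix θ z) (hu : IsMatrix θ u) :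
    IsMatrix θ (fun f => D.m e (x f) (y f) (z f) (u f)) := by
  obtain ⟨t, ht⟩ := D.isTerm e
  have hM : ∀ s, IsMatrix θ ((![x, y, z, u] : Fin 4 → (Fin k → Bool) → A.carrier) s) := by
    intro s
    fin_cases s <;> assumption
  convert IsMatrix.term t hM using 2 with f
  rw [ht]
  congr 1
  funext s
  fin_cases s <;> rfl

/-- Gumm's criterion for a pair to lie in a congruence, in terms of Day operations. -/
theorem DayOps.rel_of_forall {σ : Signature} {A : Alg σ} {n : ℕ} (D : DayOps A n)
    (δ : Congruence A) {a b c d : A.carrier} (hbd : δ.rel b d)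
    (h : ∀ e, δ.rel (D.m e a b d c) (D.m e a a c c)) : δ.rel a c := by
  have key : ∀ e (he : e < n + 1), δ.rel a (D.m ⟨e, he⟩ a b d c) := by
    intro e
    induction e with
    | zero =>
      intro he
      have h0 : D.m ⟨0, he⟩ a b d c = a := D.first a b d c
      rw [h0]
      exact δ.iseqv.refl a
    | succ e ih =>
      intro he
      refine δ.iseqv.trans (ih (by omega)) ?_
      rcases Nat.even_or_odd e with hp | hp
      · refine δ.iseqv.trans (h _) ?_
        rw [D.even e (by omega) hp]
        exact δ.iseqv.symm (h _)
      · have hs : ∀ e, δ.rel (D.m e a b d c) (D.m e a b b c) := fun e =>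
          D.rel δ e (δ.iseqv.refl a) (δ.iseqv.refl b) (δ.iseqv.symm hbd) (δ.iseqv.refl c)
        refine δ.iseqv.trans (hs _) ?_
        rw [D.odd e (by omega) hp]
        exact δ.iseqv.symm (hs _)
  have hlast := key n (by omega)
  have hc : D.m ⟨n, by omega⟩ a b d c = c := D.last a b d c
  rwa [hc] at hlast

theorem CMat_of_CttMat {σ : Signature} {A : Alg σ} {k : ℕ} {θ : Fin k → Congruence A}
    {δ : Congruence A} (H : CttMat θ δ) (j : Fin k) : CMat θ j δ := by
  intro m hm hsupp
  refine H (fun f => m (Function.update f j false)) m (hm.update j false) hm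
    (fun f hf => ?_) (fun _ => true)
  rcases hfj : f j with _ | _
  · have : Function.update f j false = f := by rw [← hfj, Function.update_eq_self]
    simpa only [this] using δ.iseqv.refl _
  · obtain ⟨i, hi⟩ := Function.ne_iff.mp hf
    have hi' : f i = false := by simpa using hi
    have hline := hsupp f ⟨i, by rintro rfl; simp [hfj] at hi', hi'⟩
    rwa [← hfj, Function.update_eq_self] at hline

/-- With Day operations, centralization at a single coordinate implies the two term condition. -/
theorem CttMat_of_CMat {σ : Signature} {A : Alg σ} {n k : ℕ} (D : DayOps A n)
    {θ : Fin k → Congruence A} {δ : Congruence A} {j : Fin k} (H : CMat θ j δ) :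
    CttMat θ δ := by
  intro h g hh hg hoff f
  by_cases hf : f = fun _ => true
  swap
  · exact hoff f hf
  subst hf
  have hne : Function.update (fun _ : Fin k => true) j false ≠ fun _ => true := fun he => by
    simpa using congrFun he j
  refine D.rel_of_forall δ (hoff _ hne) fun e => ?_
  have hpivot := H _ (IsMatrix.day D e (hh.update j true) hh hg (hg.update j true)) ?_
  · have hself : Function.update (fun _ : Fin k => true) j true = fun _ => true :=
      Function.update_eq_self j _
    simpa only [Function.update_idem, hself] using hpivot
  · rintro f ⟨i, hij, hi⟩
    have hrel : ∀ c, δ.rel (g (Function.update f j c)) (h (Function.update f j c)) := fun c =>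
      δ.iseqv.symm (hoff _ fun he => by simpa [hij, hi] using congrFun he i)
    have hidem : ∀ c, δ.rel (D.m e (h (Function.update f j true)) (h (Function.update f j c))
        (g (Function.update f j c)) (g (Function.update f j true)))
        (h (Function.update f j true)) := fun c => by
      have := D.rel δ e (δ.iseqv.refl (h (Function.update f j true)))
        (δ.iseqv.refl (h (Function.update f j c))) (hrel c) (hrel true)
      rwa [D.idem] at this
    simpa only [Function.update_idem] using
      δ.iseqv.trans (hidem false) (δ.iseqv.symm (hidem true))

theorem CMat_iff_CttMat {σ : Signature} (A : Alg σ) (n : ℕ) (D : DayOps A n)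
    (k : ℕ) (hk : 2 ≤ k) (θ : Fin k → Congruence A) (δ : Congruence A) :
    (∀ j : Fin k, CMat θ j δ) ↔ CttMat θ δ :=
  ⟨fun H => CttMat_of_CMat D (H ⟨0, by omega⟩), CMat_of_CttMat⟩

end UACommutator
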